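/- Let H be a d×d Hermitian complex matrix and H_k a (k+1)×(k+1) Hermitian tridiagonal matrix (i.e., (H_k)_{ij} = 0 whenever |i−j| > 1). Let V be a d×(k+1) complex matrix with orthonormal columns (V†V = I), set |r⟩ = V|e_0⟩, and assume the recurrence H V = V H_k + |v⟩⟨e_k| holds for some vector |v⟩ ∈ ℂ^d (where |e_j⟩ denotes the j-th standard basis vector of ℂ^{k+1}, indexed from 0). Then for every polynomial p with complex coefficients of degree at most 2k, one has ⟨r| p(H) |r⟩ = ⟨e_0| p(H_k) |e_0⟩. -/

import Mathlib

open Matrix Polynomial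

/-- The vector `A ^ j e₀` is supported on the indices `≤ j` when `A` vanishes below its first
subdiagonal. -/
lemma pow_mulVec_single_zero_apply_eq_zero {R : Type*} [CommRing R] {k : ℕ}
    (A : Matrix (Fin (k + 1)) (Fin (k + 1)) R)
    (hA : ∀ i j : Fin (k + 1), (j : ℕ) + 1 < i → A i j = 0) (j : ℕ) (i : Fin (k + 1))
    (hi : j < i) : ((A ^ j) *ᵥ Pi.single 0 1) i = 0 := by
  induction j generalizing i with
  | zero =>
    have h : i ≠ 0 := by
      rintro rfl
      simp at hi
    simp [h]
  | succ j ih =>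
    rw [pow_succ', ← mulVec_mulVec]
    simp only [mulVec, dotProduct] at ih ⊢
    refine Finset.sum_eq_zero fun l _ => ?_
    by_cases hl : j < (l : ℕ)
    · rw [ih l hl, mul_zero]
    · rw [hA i l (by omega), zero_mul]

/-- A Krylov recurrence with residual in the last column intertwines powers up to `k`. -/
lemma pow_mulVec_mulVec_single_zero {R m : Type*} [CommRing R] [Fintype m] [DecidableEq m] {k : ℕ}
    (H : Matrix m m R) (A : Matrix (Fin (k + 1)) (Fin (k + 1)) R)
    (hA : ∀ i j : Fin (k + 1), (j : ℕ) + 1 < i → A i j = 0)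
    (V : Matrix m (Fin (k + 1)) R) (v : m → R)
    (hRec : H * V = V * A + vecMulVec v (Pi.single (Fin.last k) 1)) (j : ℕ) (hj : j ≤ k) :
    (H ^ j) *ᵥ (V *ᵥ Pi.single 0 1) = V *ᵥ ((A ^ j) *ᵥ Pi.single 0 1) := by
  induction j with
  | zero => rw [pow_zero, pow_zero, one_mulVec, one_mulVec]
  | succ j ih =>
    have h0 := pow_mulVec_single_zero_apply_eq_zero A hA j (Fin.last k) (by simpa using hj)
    rw [pow_succ', ← mulVec_mulVec, ih (by omega), mulVec_mulVec, hRec, add_mulVec,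
      vecMulVec_mulVec, single_one_dotProduct, h0, pow_succ', ← mulVec_mulVec, ← mulVec_mulVec]
    simp

/-- A Hermitian power can be split between the two sides of a sesquilinear form. -/
lemma star_dotProduct_pow_add_mulVec {R m : Type*} [CommRing R] [StarRing R] [Fintype m]
    [DecidableEq m] {H : Matrix m m R} (hH : H.IsHermitian) (x : m → R) (a b : ℕ) :
    star x ⬝ᵥ ((H ^ (a + b)) *ᵥ x) = star ((H ^ a) *ᵥ x) ⬝ᵥ ((H ^ b) *ᵥ x) := by
  rw [star_mulVec, (hH.pow a).eq, ← dotProduct_mulVec, mulVec_mulVec, pow_add]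

/-- A bilinear form in a polynomial of a matrix is the combination of its moments. -/
lemma dotProduct_aeval_mulVec {R m : Type*} [CommRing R] [Fintype m] [DecidableEq m]
    (A : Matrix m m R) (x y : m → R) (p : R[X]) :
    x ⬝ᵥ ((aeval A p) *ᵥ y) =
      ∑ n ∈ Finset.range (p.natDegree + 1), p.coeff n * (x ⬝ᵥ ((A ^ n) *ᵥ y)) := by
  simp [aeval_eq_sum_range, sum_mulVec, dotProduct_sum, smul_mulVec]

/-- Exactness of Lanczos moments: if `H` is Hermitian, `H_k` is Hermitian tridiagonal,
`V` has orthonormal columns, `r = V e₀`, and `H V = V H_k + v eₖᵀ`, then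
`⟨r| p(H) |r⟩ = ⟨e₀| p(H_k) |e₀⟩` for every polynomial `p` of degree at most `2k`. -/
theorem lanczos_moments_exact {d k : ℕ}
    (H : Matrix (Fin d) (Fin d) ℂ) (hH : H.IsHermitian)
    (Hk : Matrix (Fin (k + 1)) (Fin (k + 1)) ℂ) (hHk : Hk.IsHermitian)
    (hTri : ∀ i j : Fin (k + 1), 1 < |(i : ℤ) - (j : ℤ)| → Hk i j = 0)
    (V : Matrix (Fin d) (Fin (k + 1)) ℂ) (hV : Vᴴ * V = 1)
    (v : Fin d → ℂ)
    (hRec : H * V = V * Hk + Matrix.vecMulVec v (Pi.single (Fin.last k) 1))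
    (r : Fin d → ℂ) (hr : r = V *ᵥ Pi.single 0 1)
    (p : Polynomial ℂ) (hp : p.natDegree ≤ 2 * k) :
    star r ⬝ᵥ ((aeval H p) *ᵥ r) =
      star (Pi.single 0 1 : Fin (k + 1) → ℂ) ⬝ᵥ ((aeval Hk p) *ᵥ Pi.single 0 1) := by
  have hA : ∀ i j : Fin (k + 1), (j : ℕ) + 1 < i → Hk i j = 0 := fun i j hij =>
    hTri i j (lt_abs.mpr (Or.inl (by omega)))
  rw [dotProduct_aeval_mulVec, dotProduct_aeval_mulVec]
  refine Finset.sum_congr rfl fun n hn => ?_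
  rw [Finset.mem_range] at hn
  obtain ⟨a, b, ha, hb, rfl⟩ : ∃ a b, a ≤ k ∧ b ≤ k ∧ n = a + b :=
    ⟨n / 2, n - n / 2, by omega, by omega, by omega⟩
  rw [star_dotProduct_pow_add_mulVec hH, star_dotProduct_pow_add_mulVec hHk, hr,
    pow_mulVec_mulVec_single_zero H Hk hA V v hRec a ha,
    pow_mulVec_mulVec_single_zero H Hk hA V v hRec b hb, star_mulVec, ← dotProduct_mulVec,
    mulVec_mulVec _ Vᴴ V, hV, one_mulVec]
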